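/- Let X be simple and k, ℓ ≥ 1. If β(X^(k)) and β(X^(ℓ)) are relatively prime, then β(X^(kℓ)) = β(X^(k)) · β(X^(ℓ)). -/

import Mathlib

open MeasureTheory Filter Set ProbabilityTheory

/-- A discrete-time Markov chain on a state space `S`: a stochastic transition
matrix `P`, an initial distribution `init`, and the induced probability measure
`μ` on the path space `ℕ → S`, determined by its values on cylinder sets. -/
structure MarkovChain (S : Type) [MeasurableSpace S] where
  P : S → S → ℝ
  P_nonneg : ∀ i j, 0 ≤ P i j
  P_stochastic : ∀ i, HasSum (P i) 1
  init : S → ℝ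
  init_nonneg : ∀ i, 0 ≤ init i
  init_hasSum : HasSum init 1
  μ : Measure (ℕ → S)
  μ_prob : IsProbabilityMeasure μ
  μ_cylinder : ∀ (n : ℕ) (s : ℕ → S),
    μ {ω | ∀ k ≤ n, ω k = s k}
      = ENNReal.ofReal (init (s 0) * ∏ k ∈ Finset.range n, P (s k) (s (k + 1)))

namespace MarkovChain

variable {S : Type} [MeasurableSpace S]

open Classical in
/-- The `n`-step transition probabilities `P^n(i,j)`. -/
noncomputable def Pn (X : MarkovChain S) : ℕ → S → S → ℝ
  | 0, i, j => if i = j then 1 else 0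
  | n + 1, i, j => ∑' k : S, X.Pn n i k * X.P k j

/-- Irreducibility: every state can be reached from every state. -/
def Irreducible (X : MarkovChain S) : Prop := ∀ i j : S, ∃ n : ℕ, 0 < X.Pn n i j

/-- Aperiodicity: for each state, the gcd of the set `{n ≥ 1 | P^n(i,i) > 0}`
is `1` (expressed via common divisors). -/
def Aperiodic (X : MarkovChain S) : Prop :=
  ∀ i : S, ∀ d : ℕ, (∀ n : ℕ, 0 < n → 0 < X.Pn n i i → d ∣ n) → d = 1

/-- `U^(m)(C)`: the event that the `m`-step chain visits `C` infinitely often. -/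
def U (X : MarkovChain S) (m : ℕ) (C : Set S) : Set (ℕ → S) :=
  {ω | ∀ n : ℕ, ∃ k : ℕ, n ≤ k ∧ ω (k * m) ∈ C}

/-- `L^(m)(C)`: the event that the `m`-step chain is eventually in `C`. -/
def L (X : MarkovChain S) (m : ℕ) (C : Set S) : Set (ℕ → S) :=
  {ω | ∃ n : ℕ, ∀ k : ℕ, n ≤ k → ω (k * m) ∈ C}

/-- `C` is transient with respect to the `m`-step chain `X^(m)`. -/
def Transient (X : MarkovChain S) (m : ℕ) (C : Set S) : Prop := X.μ (X.U m C) = 0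

/-- `C` is regular with respect to `X^(m)`: `U^(m)(C)` and `L^(m)(C)` agree up
to a null event. -/
def Regular (X : MarkovChain S) (m : ℕ) (C : Set S) : Prop :=
  X.μ (symmDiff (X.U m C) (X.L m C)) = 0

/-- `C` is almost closed with respect to `X^(m)`: regular but not transient. -/
def AlmostClosed (X : MarkovChain S) (m : ℕ) (C : Set S) : Prop :=
  X.Regular m C ∧ ¬ X.Transient m C

/-- An almost closed set is atomic if it does not contain two disjoint almost
closed subsets. -/
def Atomic (X : MarkovChain S) (m : ℕ) (C : Set S) : Prop :=
  X.AlmostClosed m C ∧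
    ¬ ∃ A B : Set S, A ⊆ C ∧ B ⊆ C ∧ Disjoint A B ∧
      X.AlmostClosed m A ∧ X.AlmostClosed m B

/-- A Blackwell decomposition for the `m`-step chain `X^(m)`: a countable
collection of pairwise disjoint almost closed sets, all atomic except at most
one, where a nonatomic member contains no atomic subsets and consists of
transient states, and such that the probabilities `μ(L^(m)(C))` sum to one. -/
structure IsBlackwell (X : MarkovChain S) (m : ℕ) (𝒞 : Set (Set S)) : Prop where
  countable : 𝒞.Countable
  almostClosed : ∀ C ∈ 𝒞, X.AlmostClosed m C
  disjoint : 𝒞.PairwiseDisjoint id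
  atMostOneNonatomic : ∀ C₁ ∈ 𝒞, ∀ C₂ ∈ 𝒞, ¬ X.Atomic m C₁ → ¬ X.Atomic m C₂ → C₁ = C₂
  nonatomicNoAtomicSubset : ∀ C ∈ 𝒞, ¬ X.Atomic m C → ∀ A : Set S, A ⊆ C → ¬ X.Atomic m A
  nonatomicTransientStates : ∀ C ∈ 𝒞, ¬ X.Atomic m C → ∀ i ∈ C, X.Transient m {i}
  sum_L_eq_one : ∑' C : 𝒞, X.μ (X.L m (C : Set S)) = 1

/-- `β(X^(m))`: the number of sets in a Blackwell decomposition for `X^(m)`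
(well defined since the decomposition is unique up to equivalence). -/
noncomputable def beta (X : MarkovChain S) (m : ℕ) : ℕ∞ :=
  sInf (Set.encard '' {𝒞 : Set (Set S) | X.IsBlackwell m 𝒞})

/-- `X` is simple if `β(X) = 1`. -/
def Simple (X : MarkovChain S) : Prop := X.beta 1 = 1

/-- The asymptotic period `d(X) = sup {m ≥ 1 | β(X^(m)) = m}` (possibly `∞`). -/
noncomputable def period (X : MarkovChain S) : ℕ∞ :=
  sSup {d : ℕ∞ | ∃ m : ℕ, 1 ≤ m ∧ X.beta m = (m : ℕ∞) ∧ d = (m : ℕ∞)}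

/-- Recurrence: every state is visited infinitely often almost surely. -/
def Recurrent (X : MarkovChain S) : Prop := ∀ i : S, X.μ (X.U 1 {i}) = 1

end MarkovChain

/-- The shift operator `θ` on path space: `(θ ω)(n) = ω(n+1)`. -/
def pathShift {S : Type} : (ℕ → S) → ℕ → S := fun ω n => ω (n + 1)

/-- An event `E` is `m`-invariant if its indicator function `f` satisfies
`f(ω) = f(θ^m ω)` for all paths `ω`. -/
def MInvariant {S : Type} (m : ℕ) (E : Set (ℕ → S)) : Prop :=
  ∀ ω : ℕ → S, ω ∈ E ↔ pathShift^[m] ω ∈ E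

/-- A birth-death process: a Markov chain on `ℕ` with positive birth
probabilities `p_i = P(i,i+1)`, positive death probabilities `q_{i+1} = P(i+1,i)`,
all transition probabilities other than `p_i`, `q_i` and `r_i = P(i,i)` zero,
and at least one positive self-transition probability. -/
structure MarkovChain.IsBirthDeath (X : MarkovChain ℕ) : Prop where
  birth_pos : ∀ i : ℕ, 0 < X.P i (i + 1)
  death_pos : ∀ i : ℕ, 0 < X.P (i + 1) i
  tridiagonal : ∀ i j : ℕ, 1 < |(i : ℤ) - (j : ℤ)| → X.P i j = 0
  self_pos : ∃ i : ℕ, 0 < X.P i i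

section QuasiErgodicIterates

variable {Ω : Type*} {T : Ω → Ω}

lemma iterate_preimage_preimage (T : Ω → Ω) (a b : ℕ) (E : Set Ω) :
    T^[a] ⁻¹' (T^[b] ⁻¹' E) = T^[b + a] ⁻¹' E := by
  ext x
  simp [Function.iterate_add_apply]

lemma iterate_preimage_eq_of_dvd {d m : ℕ} {E : Set Ω} (hE : T^[d] ⁻¹' E = E) (h : d ∣ m) :
    T^[m] ⁻¹' E = E := by
  obtain ⟨c, rfl⟩ := h
  induction c with
  | zero => simp
  | succ c ih => rw [Nat.mul_succ, ← iterate_preimage_preimage, ih, hE]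

lemma iterate_preimage_eq_preimage_mod {d : ℕ} {E : Set Ω} (hE : T^[d] ⁻¹' E = E) (j : ℕ) :
    T^[j] ⁻¹' E = T^[j % d] ⁻¹' E := by
  conv_lhs => rw [← Nat.div_add_mod j d, ← iterate_preimage_preimage,
    iterate_preimage_eq_of_dvd hE (dvd_mul_right d _)]

lemma iterate_preimage_comm {m : ℕ} {E : Set Ω} (hE : T^[m] ⁻¹' E = E) (j : ℕ) :
    T^[m] ⁻¹' (T^[j] ⁻¹' E) = T^[j] ⁻¹' E := by
  rw [iterate_preimage_preimage, add_comm, ← iterate_preimage_preimage, hE]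

lemma iterate_preimage_iUnion_mul {g n : ℕ} (hn : 0 < n) (hg : g ∣ n) {G : Set Ω}
    (hG : T^[n] ⁻¹' G = G) :
    T^[g] ⁻¹' (⋃ i : ℕ, T^[g * i] ⁻¹' G) = ⋃ i : ℕ, T^[g * i] ⁻¹' G := by
  rw [preimage_iUnion]
  simp_rw [iterate_preimage_preimage]
  apply Set.Subset.antisymm
  · exact iUnion_subset fun i => subset_iUnion_of_subset (i + 1) (by rw [Nat.mul_succ])
  · refine iUnion_subset fun i => ?_
    obtain ⟨c, rfl⟩ := hg
    have hc : 0 < c := Nat.pos_of_mul_pos_left hn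
    refine subset_iUnion_of_subset (i + c - 1) ?_
    have : g * (i + c - 1) + g = g * c + g * i := by
      rw [← Nat.mul_succ, Nat.succ_eq_add_one, Nat.sub_add_cancel (by omega)]; ring
    rw [this, ← iterate_preimage_preimage, hG]

variable [MeasurableSpace Ω] {ν : Measure Ω}

lemma ae_eq_iterate_preimage_of_ae_le (hT : Measure.QuasiMeasurePreserving T ν ν) {m j : ℕ}
    (hm : 0 < m) {F : Set Ω} (hF : T^[m] ⁻¹' F = F) (h : F ≤ᵐ[ν] T^[j] ⁻¹' F) :
    F =ᵐ[ν] T^[j] ⁻¹' F := by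
  have h2 : ∀ i, F ≤ᵐ[ν] T^[j * i] ⁻¹' F := by
    intro i
    induction i with
    | zero => exact EventuallyLE.refl _ _
    | succ i ih =>
      have := (hT.iterate j).preimage_mono_ae ih
      rw [iterate_preimage_preimage, ← Nat.mul_succ] at this
      exact h.trans this
  have h3 := (hT.iterate j).preimage_mono_ae (h2 (m - 1))
  rw [iterate_preimage_preimage, ← Nat.mul_succ, Nat.succ_eq_add_one, Nat.sub_add_cancel hm,
    iterate_preimage_eq_of_dvd hF (dvd_mul_left m j)] at h3
  exact h.antisymm h3

/-- An atom of the `σ`-algebra of `T^[m]`-invariant sets. -/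
structure IsInvAtom (ν : Measure Ω) (T : Ω → Ω) (m : ℕ) (E : Set Ω) : Prop where
  meas : MeasurableSet E
  inv : T^[m] ⁻¹' E = E
  ne_zero : ν E ≠ 0
  atom : ∀ F, MeasurableSet F → T^[m] ⁻¹' F = F → AEDisjoint ν E F ∨ E ≤ᵐ[ν] F

/-- A non-null set whose iterated preimages are periodic with exact period `d`, two distinct ones
being almost everywhere disjoint. -/
structure IsCyclicSet (ν : Measure Ω) (T : Ω → Ω) (d : ℕ) (E : Set Ω) : Prop where
  meas : MeasurableSet E
  pos : 0 < d
  inv : T^[d] ⁻¹' E = E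
  ne_zero : ν E ≠ 0
  disj : ∀ j, ¬ d ∣ j → AEDisjoint ν E (T^[j] ⁻¹' E)

/-- A non-null set meets each iterated-preimage orbit of an invariant non-null set. -/
lemma PreErgodic.exists_not_aedisjoint (hT : PreErgodic T ν) (hTm : Measurable T) {m : ℕ}
    (hm : 0 < m) {F G : Set Ω} (hF : MeasurableSet F) (hFi : T^[m] ⁻¹' F = F) (hF0 : ν F ≠ 0)
    (hG : ν G ≠ 0) : ∃ j, ¬ AEDisjoint ν G (T^[j] ⁻¹' F) := by
  by_contra! hcon
  have hV : T ⁻¹' (⋃ j, T^[j] ⁻¹' F) = ⋃ j, T^[j] ⁻¹' F := by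
    apply Set.Subset.antisymm
    · rw [preimage_iUnion]
      refine iUnion_subset fun j => ?_
      refine subset_iUnion_of_subset (j + 1) ?_
      intro x hx
      simpa [Function.iterate_succ_apply] using hx
    · rw [preimage_iUnion]
      refine iUnion_subset fun j => ?_
      have : T^[j] ⁻¹' F = T^[(j + m - 1) + 1] ⁻¹' F := by
        rw [Nat.sub_add_cancel (by omega), add_comm, ← iterate_preimage_preimage, hFi]
      rw [this]
      refine subset_iUnion_of_subset (j + m - 1) ?_
      intro x hx
      simpa [Function.iterate_succ_apply] using hx
  have hVm : MeasurableSet (⋃ j, T^[j] ⁻¹' F) :=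
    MeasurableSet.iUnion fun j => (hTm.iterate j) hF
  rcases hT.measure_self_or_compl_eq_zero hVm hV with h | h
  · exact hF0 (measure_mono_null (subset_iUnion_of_subset 0 (by simp)) h)
  · apply hG
    have h1 : ν (G ∩ ⋃ j, T^[j] ⁻¹' F) = 0 := by
      rw [inter_iUnion]
      exact measure_iUnion_null hcon
    refine measure_mono_null (t := (G ∩ ⋃ j, T^[j] ⁻¹' F) ∪ (⋃ j, T^[j] ⁻¹' F)ᶜ) ?_
      (measure_union_null h1 h)
    intro x hx
    by_cases hx' : x ∈ ⋃ j, T^[j] ⁻¹' F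
    · exact Or.inl ⟨hx, hx'⟩
    · exact Or.inr hx'

lemma IsInvAtom.preimage {m : ℕ} {E : Set Ω} (hT : Measure.QuasiMeasurePreserving T ν ν)
    (hm : 0 < m) (hE : IsInvAtom ν T m E) (j : ℕ) : IsInvAtom ν T m (T^[j] ⁻¹' E) := by
  have hback : ∀ F : Set Ω, T^[m] ⁻¹' F = F → T^[j] ⁻¹' (T^[m * j - j] ⁻¹' F) = F := by
    intro F hF
    have : j ≤ m * j := Nat.le_mul_of_pos_left j hm
    rw [iterate_preimage_preimage, Nat.sub_add_cancel this,
      iterate_preimage_eq_of_dvd hF (dvd_mul_right m j)]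
  refine ⟨(hT.iterate j).measurable hE.meas, iterate_preimage_comm hE.inv j, fun h => ?_, ?_⟩
  · apply hE.ne_zero
    have := (hT.iterate (m * j - j)).preimage_null h
    rwa [iterate_preimage_preimage, add_comm, ← iterate_preimage_preimage, hback E hE.inv] at this
  · intro F hF hFi
    have hF' := hE.atom (T^[m * j - j] ⁻¹' F) ((hT.iterate _).measurable hF)
      (iterate_preimage_comm hFi _)
    rcases hF' with h | h
    · left
      have := h.preimage (hT.iterate j)
      rwa [hback F hFi] at this
    · right
      have := (hT.iterate j).preimage_mono_ae h
      rwa [hback F hFi] at this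

/-- The period of a cyclic set divides every period of an atom. -/
lemma IsCyclicSet.dvd_of_isInvAtom (hT : QuasiErgodic T ν) {a m n : ℕ} {E G : Set Ω} (hm : 0 < m)
    (hE : IsCyclicSet ν T a E) (ham : a ∣ m) (hG : IsInvAtom ν T m G) (hGn : T^[n] ⁻¹' G = G) :
    a ∣ n := by
  by_contra han
  have hEm := iterate_preimage_eq_of_dvd hE.inv ham
  obtain ⟨j, hj⟩ := hT.toPreErgodic.exists_not_aedisjoint hT.measurable hm hE.meas hEm hE.ne_zero
    hG.ne_zero
  have h1 : G ≤ᵐ[ν] T^[j] ⁻¹' E :=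
    (hG.atom _ ((hT.iterate j).measurable hE.meas) (iterate_preimage_comm hEm j)).resolve_left hj
  have h2 := (hT.iterate n).preimage_mono_ae h1
  rw [hGn, iterate_preimage_preimage, ← iterate_preimage_preimage, iterate_preimage_preimage,
    add_comm, ← iterate_preimage_preimage] at h2
  have h3 := (hE.disj n han).preimage (hT.iterate j)
  apply hG.ne_zero
  rw [← ae_eq_empty] 
  have h3' : ∀ᵐ x ∂ν, x ∉ (T^[j] ⁻¹' E) ∩ (T^[j] ⁻¹' (T^[n] ⁻¹' E)) := measure_eq_zero_iff_ae_notMem.1 h3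
  filter_upwards [h1, h2, h3'] with x h1 h2 h3
  apply propext
  constructor
  · intro h
    exact h3 ⟨h1 h, h2 h⟩
  · intro h; exact h.elim

lemma IsCyclicSet.exists_of_dvd (hT : Measure.QuasiMeasurePreserving T ν ν) {n g : ℕ} {G : Set Ω}
    (hG : IsCyclicSet ν T n G) (hg : g ∣ n) : ∃ H, IsCyclicSet ν T g H := by
  have hg0 : 0 < g := Nat.pos_of_dvd_of_pos hg hG.pos
  refine ⟨⋃ i : ℕ, T^[g * i] ⁻¹' G, MeasurableSet.iUnion fun i => (hT.iterate _).measurable hG.meas,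
    hg0, ?_, fun h => hG.ne_zero (measure_mono_null (subset_iUnion_of_subset 0 (by simp)) h), ?_⟩
  · exact iterate_preimage_iUnion_mul hG.pos hg hG.inv
  · intro j hj
    rw [preimage_iUnion, AEDisjoint.iUnion_left_iff]
    intro i
    rw [AEDisjoint.iUnion_right_iff]
    intro i'
    rw [iterate_preimage_preimage]
    -- shift both sets past `g * i`
    have key : ¬ n ∣ (g * i' + j + (n * i - g * i)) := by
      intro h
      have h1 : g ∣ g * i' + j + (n * i - g * i) := hg.trans h
      have h2 : g ∣ (n * i - g * i) :=
        Nat.dvd_sub (hg.mul_right i) (dvd_mul_right g i)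
      have h3 := (Nat.dvd_add_left h2).1 h1
      exact hj ((Nat.dvd_add_right (dvd_mul_right g i')).1 h3)
    have h := (hG.disj _ key).preimage (hT.iterate (g * i))
    rw [iterate_preimage_preimage] at h
    have hgi : g * i ≤ n * i := Nat.mul_le_mul_right i (Nat.le_of_dvd hG.pos hg)
    have e : g * i' + j + (n * i - g * i) + g * i = g * i' + j + n * i := by omega
    rwa [e, add_comm, ← iterate_preimage_preimage,
      iterate_preimage_eq_of_dvd hG.inv (dvd_mul_right n i)] at h

open Classical in
/-- The number of iterated preimages `T^{-j} E` with `j < m` that meet `E` in a non-null set. -/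
noncomputable def overlapCount (ν : Measure Ω) (T : Ω → Ω) (m : ℕ) (E : Set Ω) : ℕ :=
  ((Finset.range m).filter fun j => ¬ AEDisjoint ν E (T^[j] ⁻¹' E)).card

lemma not_aedisjoint_of_overlapCount_le {m : ℕ} (hm : 0 < m) {E F : Set Ω} (h : F ⊆ E)
    (hE : T^[m] ⁻¹' E = E) (hF : T^[m] ⁻¹' F = F)
    (hle : overlapCount ν T m E ≤ overlapCount ν T m F) {j : ℕ}
    (hj : ¬ AEDisjoint ν E (T^[j] ⁻¹' E)) : ¬ AEDisjoint ν F (T^[j] ⁻¹' F) := by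
  classical
  rw [iterate_preimage_eq_preimage_mod hE] at hj
  rw [iterate_preimage_eq_preimage_mod hF]
  have hsub : ((Finset.range m).filter fun j => ¬ AEDisjoint ν F (T^[j] ⁻¹' F)) ⊆
      (Finset.range m).filter fun j => ¬ AEDisjoint ν E (T^[j] ⁻¹' E) := by
    intro j hj
    simp only [Finset.mem_filter] at hj ⊢
    exact ⟨hj.1, fun h' => hj.2 (h'.mono h (preimage_mono h))⟩
  have heq := Finset.eq_of_subset_of_card_le hsub (by convert hle using 1 <;> rfl)
  have : j % m ∈ (Finset.range m).filter fun j => ¬ AEDisjoint ν E (T^[j] ⁻¹' E) := by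
    simp only [Finset.mem_filter, Finset.mem_range]
    exact ⟨Nat.mod_lt _ hm, hj⟩
  rw [← heq] at this
  exact (Finset.mem_filter.1 this).2

/-- For a quasi-ergodic map the invariant `σ`-algebra of `T^[m]` has an atom, and the preimages of
a suitable atom form a cycle whose length divides `m`. -/
lemma QuasiErgodic.exists_isCyclicSet_isInvAtom (hT : QuasiErgodic T ν) (hν : ν ≠ 0) {m : ℕ}
    (hm : 0 < m) : ∃ d E, d ∣ m ∧ IsCyclicSet ν T d E ∧ IsInvAtom ν T m E := by
  classical
  let 𝒮 : Set (Set Ω) := {E | MeasurableSet E ∧ T^[m] ⁻¹' E = E ∧ ν E ≠ 0}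
  have hne : 𝒮.Nonempty := ⟨univ, MeasurableSet.univ, preimage_univ, by simpa using hν⟩
  obtain ⟨E, ⟨hEm, hEi, hE0⟩, hmin⟩ :=
    (measure (overlapCount ν T m)).wf.has_min 𝒮 hne
  replace hmin : ∀ F ∈ 𝒮, overlapCount ν T m E ≤ overlapCount ν T m F :=
    fun F hF => not_lt.1 (hmin F hF)
  have hqm := hT.toQuasiMeasurePreserving
  have key : ∀ F ∈ 𝒮, F ⊆ E → ∀ j, ¬ AEDisjoint ν E (T^[j] ⁻¹' E) → F ≤ᵐ[ν] T^[j] ⁻¹' F := by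
    intro F hF hFE j hj
    rw [ae_le_set]
    by_contra h0
    have hG : F \ T^[j] ⁻¹' F ∈ 𝒮 := by
      refine ⟨hF.1.diff ((hqm.iterate j).measurable hF.1), ?_, h0⟩
      rw [preimage_sdiff, iterate_preimage_comm hF.2.1, hF.2.1]
    refine not_aedisjoint_of_overlapCount_le hm (sdiff_subset.trans hFE) hEi hG.2.1
      (hmin _ hG) hj ?_
    refine Disjoint.aedisjoint (disjoint_left.2 fun x hx hx' => hx.2 hx'.1)
  have hatom : ∀ F ∈ 𝒮, F ⊆ E → E ≤ᵐ[ν] F := by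
    intro F hF hFE
    rw [ae_le_set]
    by_contra h0
    obtain ⟨j, hj⟩ := hT.toPreErgodic.exists_not_aedisjoint hqm.measurable hm hF.1 hF.2.1 hF.2.2 h0
    have hEj : ¬ AEDisjoint ν E (T^[j] ⁻¹' E) :=
      fun h => hj (h.mono sdiff_subset (preimage_mono hFE))
    have h1 := key F hF hFE j hEj
    have h3 := ae_eq_iterate_preimage_of_ae_le hqm hm hF.2.1 (key F hF hFE j hEj)
    apply hj
    have h4 : ∀ᵐ x ∂ν, x ∉ E \ F ∩ T^[j] ⁻¹' F := by
      filter_upwards [h3.symm.le] with x hx hx'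
      exact hx'.1.2 (hx hx'.2)
    exact measure_eq_zero_iff_ae_notMem.2 h4
  have hJ : ∃ j, 0 < j ∧ E =ᵐ[ν] T^[j] ⁻¹' E := ⟨m, hm, by rw [hEi]; exact EventuallyEq.rfl⟩
  let d := Nat.find hJ
  obtain ⟨hd0, hdE⟩ : 0 < d ∧ E =ᵐ[ν] T^[d] ⁻¹' E := Nat.find_spec hJ
  have hmul : ∀ q, E =ᵐ[ν] T^[d * q] ⁻¹' E := by
    intro q
    induction q with
    | zero => exact EventuallyEq.refl _ _
    | succ q ih =>
      have := (hqm.iterate d).preimage_ae_eq ih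
      rw [iterate_preimage_preimage, ← Nat.mul_succ] at this
      exact hdE.trans this
  have hdvd : ∀ j, E =ᵐ[ν] T^[j] ⁻¹' E → d ∣ j := by
    intro j hj
    have h1 := (hqm.iterate (j % d)).preimage_ae_eq (hmul (j / d))
    rw [iterate_preimage_preimage, Nat.div_add_mod] at h1
    by_contra hdj
    exact Nat.find_min hJ (Nat.mod_lt j hd0)
      ⟨Nat.pos_of_ne_zero fun h => hdj (Nat.dvd_of_mod_eq_zero h), hj.trans h1.symm⟩
  have hdm : d ∣ m := hdvd m (by rw [hEi]; exact EventuallyEq.rfl)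
  have hinv := iterate_preimage_iUnion_mul hm hdm hEi
  have hEE : (⋃ i : ℕ, T^[d * i] ⁻¹' E : Set Ω) =ᵐ[ν] E := by
    have := Filter.EventuallyEq.countable_iUnion fun q => (hmul q).symm
    rwa [iUnion_const] at this
  have hE'm : MeasurableSet (⋃ i : ℕ, T^[d * i] ⁻¹' E) :=
    MeasurableSet.iUnion fun i => (hqm.iterate _).measurable hEm
  have hE'0 : ν (⋃ i : ℕ, T^[d * i] ⁻¹' E) ≠ 0 := by rwa [measure_congr hEE]
  refine ⟨d, ⋃ i : ℕ, T^[d * i] ⁻¹' E, hdm, ⟨hE'm, hd0, hinv, hE'0, fun j hj => ?_⟩,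
    hE'm, iterate_preimage_eq_of_dvd hinv hdm, hE'0, fun F hF hFi => ?_⟩
  · refine AEDisjoint.congr ?_ hEE ((hqm.iterate j).preimage_ae_eq hEE)
    by_contra h
    exact hj (hdvd j (ae_eq_iterate_preimage_of_ae_le hqm hm hEi
      (key E ⟨hEm, hEi, hE0⟩ subset_rfl j h)))
  · by_cases h0 : ν (E ∩ F) = 0
    · exact Or.inl (AEDisjoint.congr h0 hEE EventuallyEq.rfl)
    · right
      have := hatom (E ∩ F) ⟨hEm.inter hF, by rw [preimage_inter, hEi, hFi], h0⟩ inter_subset_left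
      exact hEE.le.trans (this.trans (Eventually.of_forall fun x hx => hx.2))

lemma IsCyclicSet.eq_mul_of_coprime (hT : QuasiErgodic T ν) {k l a b n : ℕ} {E F G : Set Ω}
    (hk : 0 < k) (hl : 0 < l) (hak : a ∣ k) (hbl : b ∣ l)
    (hE : IsCyclicSet ν T a E) (hE' : IsInvAtom ν T k E)
    (hF : IsCyclicSet ν T b F) (hF' : IsInvAtom ν T l F)
    (hn : n ∣ k * l) (hG : IsCyclicSet ν T n G) (hG' : IsInvAtom ν T (k * l) G)
    (hab : Nat.Coprime a b) : n = a * b := by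
  have hkl := Nat.mul_pos hk hl
  apply Nat.dvd_antisymm
  · obtain ⟨H, hH⟩ := hG.exists_of_dvd hT.toQuasiMeasurePreserving (Nat.gcd_dvd_left n k)
    obtain ⟨H', hH'⟩ := hG.exists_of_dvd hT.toQuasiMeasurePreserving (Nat.gcd_dvd_left n l)
    exact (Nat.dvd_gcd_mul_gcd_iff_dvd_mul.2 hn).trans (Nat.mul_dvd_mul
      (hH.dvd_of_isInvAtom hT hk (Nat.gcd_dvd_right n k) hE' hE.inv)
      (hH'.dvd_of_isInvAtom hT hl (Nat.gcd_dvd_right n l) hF' hF.inv))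
  · exact hab.mul_dvd_of_dvd_of_dvd
      (hE.dvd_of_isInvAtom hT hkl (hak.mul_right l) hG' hG.inv)
      (hF.dvd_of_isInvAtom hT hkl (hbl.mul_left k) hG' hG.inv)

end QuasiErgodicIterates

section InvAtoms

variable {Ω : Type*} [MeasurableSpace Ω] {ν : Measure Ω} {T : Ω → Ω} {m : ℕ} {E F : Set Ω}

lemma IsInvAtom.congr_ae (hE : IsInvAtom ν T m E) (h : E =ᵐ[ν] F) (hF : MeasurableSet F)
    (hFi : T^[m] ⁻¹' F = F) : IsInvAtom ν T m F :=
  ⟨hF, hFi, fun h0 => hE.ne_zero (by rw [measure_congr h, h0]), fun G hG hGi =>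
    (hE.atom G hG hGi).imp (fun h' => h'.congr h.symm (ae_eq_refl G)) h.symm.le.trans⟩

lemma IsInvAtom.ae_eq_of_not_aedisjoint (hE : IsInvAtom ν T m E) (hF : IsInvAtom ν T m F)
    (h : ¬ AEDisjoint ν E F) : E =ᵐ[ν] F :=
  ((hE.atom F hF.meas hF.inv).resolve_left h).antisymm
    ((hF.atom E hE.meas hE.inv).resolve_left fun h' => h h'.symm)

lemma IsInvAtom.not_aedisjoint_of_ae_eq (hE : IsInvAtom ν T m E) (h : E =ᵐ[ν] F) :
    ¬ AEDisjoint ν E F := fun h' =>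
  hE.ne_zero (by simpa [AEDisjoint] using h'.congr (ae_eq_refl E) h)

lemma IsInvAtom.iUnion_preimage (hT : Measure.QuasiMeasurePreserving T ν ν) (hm : 0 < m)
    (hE : IsInvAtom ν T m E) : IsInvAtom ν T 1 (⋃ i : ℕ, T^[1 * i] ⁻¹' E) := by
  refine ⟨MeasurableSet.iUnion fun i => (hT.iterate _).measurable hE.meas,
    iterate_preimage_iUnion_mul hm (one_dvd m) hE.inv,
    fun h => hE.ne_zero (measure_mono_null (subset_iUnion_of_subset 0 (by simp)) h), ?_⟩
  intro F hF hFi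
  rcases hE.atom F hF (iterate_preimage_eq_of_dvd hFi (one_dvd m)) with h | h
  · refine Or.inl (AEDisjoint.iUnion_left_iff.2 fun i => ?_)
    have := h.preimage (hT.iterate (1 * i))
    rwa [iterate_preimage_eq_of_dvd hFi (one_dvd _)] at this
  · right
    have : ∀ i, T^[1 * i] ⁻¹' E ≤ᵐ[ν] F := fun i => by
      have := (hT.iterate (1 * i)).preimage_mono_ae h
      rwa [iterate_preimage_eq_of_dvd hFi (one_dvd _)] at this
    simpa only [ae_le_set, iUnion_sdiff, measure_iUnion_null_iff] using this

lemma IsInvAtom.quasiErgodic (hT : Measure.QuasiMeasurePreserving T ν ν)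
    (hE : IsInvAtom ν T 1 E) (h : ν Eᶜ = 0) : QuasiErgodic T ν := by
  refine ⟨hT, ⟨fun F hF hFi => ?_⟩⟩
  have hE' : E =ᵐ[ν] univ := ae_eq_univ.2 h
  rw [eventuallyConst_set']
  rcases hE.atom F hF hFi with h | h
  · left
    have := AEDisjoint.congr h hE'.symm (ae_eq_refl F)
    exact ae_eq_empty.2 (by simpa [AEDisjoint] using this)
  · refine Or.inr (ae_eq_univ.2 (measure_mono_null (fun x hx => ?_)
      (measure_union_null (ae_le_set.1 h) (ae_eq_univ.1 hE'))))
    exact (em (x ∈ E)).imp (fun h' => ⟨h', hx⟩) id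

end InvAtoms

namespace MarkovChain

section PathSpace

variable {S : Type}

/-- The cylinder of paths agreeing with `s` up to time `n`. -/
def cyl (n : ℕ) (s : ℕ → S) : Set (ℕ → S) := {ω | ∀ k ≤ n, ω k = s k}

lemma pathShift_iterate_apply (n : ℕ) (ω : ℕ → S) (k : ℕ) : pathShift^[n] ω k = ω (k + n) := by
  induction n generalizing ω with
  | zero => rfl
  | succ n ih =>
    rw [Function.iterate_succ_apply, ih]
    simp only [pathShift]
    congr 1

/-- The path following `s` up to time `n` and `t` afterwards. -/
def concat (n : ℕ) (s t : ℕ → S) : ℕ → S := fun k => if k ≤ n then s k else t (k - n)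

lemma concat_of_le {n k : ℕ} (s t : ℕ → S) (h : k ≤ n) : concat n s t k = s k := if_pos h

lemma concat_add {n : ℕ} {s t : ℕ → S} (h : t 0 = s n) (k : ℕ) : concat n s t (k + n) = t k := by
  unfold concat
  split_ifs with hk
  · obtain rfl : k = 0 := by omega
    simp [h]
  · simp

lemma cyl_inter_preimage_cyl {n k : ℕ} {s t : ℕ → S} (h : t 0 = s n) :
    cyl n s ∩ pathShift^[n] ⁻¹' cyl k t = cyl (k + n) (concat n s t) := by
  ext ω
  simp only [cyl, mem_inter_iff, mem_ofPred_eq, mem_preimage, pathShift_iterate_apply]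
  constructor
  · rintro ⟨h1, h2⟩ j hj
    by_cases hjn : j ≤ n
    · rw [h1 j hjn, concat_of_le s t hjn]
    · obtain ⟨i, rfl⟩ := Nat.exists_eq_add_of_le' (not_le.1 hjn).le
      rw [h2 i (by omega), concat_add h]
  · intro h1
    refine ⟨fun j hj => ?_, fun j hj => ?_⟩
    · rw [h1 j (by omega), concat_of_le s t hj]
    · rw [h1 (j + n) (by omega), concat_add h]

lemma cyl_inter_preimage_cyl_of_ne {n k : ℕ} {s t : ℕ → S} (h : t 0 ≠ s n) :
    cyl n s ∩ pathShift^[n] ⁻¹' cyl k t = ∅ := by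
  ext ω
  simp only [cyl, mem_inter_iff, mem_ofPred_eq, mem_preimage, pathShift_iterate_apply,
    mem_empty_iff_false, iff_false, not_and]
  intro h1 h2
  have := h2 0 (Nat.zero_le _)
  rw [zero_add, h1 n le_rfl] at this
  exact h this.symm

lemma cyl_congr {n : ℕ} {s t : ℕ → S} (h : ∀ k ≤ n, s k = t k) : cyl n s = cyl n t := by
  ext ω
  exact forall₂_congr fun k hk => by rw [h k hk]

lemma isPiSystem_cyl : IsPiSystem {A : Set (ℕ → S) | ∃ n s, A = cyl n s} := by
  rintro _ ⟨n, s, rfl⟩ _ ⟨m, t, rfl⟩ ⟨ω, h1, h2⟩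
  have e1 : cyl n s = cyl n ω := cyl_congr fun k hk => (h1 k hk).symm
  have e2 : cyl m t = cyl m ω := cyl_congr fun k hk => (h2 k hk).symm
  refine ⟨max n m, ω, ?_⟩
  rw [e1, e2]
  ext x
  simp only [cyl, mem_inter_iff, mem_ofPred_eq, le_max_iff]
  exact ⟨fun h k hk => hk.elim (h.1 k) (h.2 k), fun h => ⟨fun k hk => h k (.inl hk),
    fun k hk => h k (.inr hk)⟩⟩

lemma exists_countable_cyl_cover [Countable S] (n : ℕ) :
    ∃ 𝒯 : Set (ℕ → S), 𝒯.Countable ∧ ∀ ω : ℕ → S, ∃ s ∈ 𝒯, ω ∈ cyl n s := by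
  refine ⟨range fun (t : Fin (n + 1) → S) (k : ℕ) => t ⟨min k n, by omega⟩, countable_range _,
    fun ω => ⟨_, ⟨fun k => ω k, rfl⟩, fun k hk => ?_⟩⟩
  simp [hk]

variable [MeasurableSpace S] [MeasurableSingletonClass S]

omit [MeasurableSingletonClass S] in
lemma measurable_pathShift : Measurable (pathShift : (ℕ → S) → ℕ → S) :=
  measurable_pi_lambda _ fun n => measurable_pi_apply (n + 1)

lemma measurableSet_cyl (n : ℕ) (s : ℕ → S) : MeasurableSet (cyl n s) := by
  have : cyl n s = ⋂ k, ⋂ (_ : k ≤ n), (fun ω : ℕ → S => ω k) ⁻¹' {s k} := by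
    ext ω
    simp [cyl]
  rw [this]
  exact MeasurableSet.iInter fun k => MeasurableSet.iInter fun _ =>
    measurable_pi_apply k (measurableSet_singleton _)

lemma generateFrom_cyl [Countable S] :
    (inferInstance : MeasurableSpace (ℕ → S)) =
      MeasurableSpace.generateFrom {A : Set (ℕ → S) | ∃ n s, A = cyl n s} := by
  apply le_antisymm
  · refine iSup_le fun k => ?_
    rintro _ ⟨B, -, rfl⟩
    obtain ⟨𝒯, h𝒯, hcov⟩ := exists_countable_cyl_cover (S := S) k
    have : (fun ω : ℕ → S => ω k) ⁻¹' B = ⋃ s ∈ {s ∈ 𝒯 | s k ∈ B}, cyl k s := by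
      ext ω
      simp only [mem_preimage, mem_ofPred_eq, mem_iUnion, exists_prop]
      constructor
      · intro h
        obtain ⟨s, hs, hω⟩ := hcov ω
        exact ⟨s, ⟨hs, by rwa [← hω k le_rfl]⟩, hω⟩
      · rintro ⟨s, ⟨-, hs⟩, hω⟩
        rwa [hω k le_rfl]
    rw [this]
    refine MeasurableSet.biUnion (h𝒯.mono (sep_subset _ _)) fun s _ => ?_
    exact MeasurableSpace.measurableSet_generateFrom ⟨k, s, rfl⟩
  · refine MeasurableSpace.generateFrom_le ?_
    rintro _ ⟨n, s, rfl⟩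
    exact measurableSet_cyl n s

omit [MeasurableSingletonClass S] in
lemma measure_eq_zero_of_cyl [Countable S] {μ : Measure (ℕ → S)} {A : Set (ℕ → S)} (n : ℕ)
    (h : ∀ s, μ (cyl n s ∩ A) = 0) : μ A = 0 := by
  obtain ⟨𝒯, h𝒯, hcov⟩ := exists_countable_cyl_cover (S := S) n
  refine measure_mono_null (t := ⋃ s ∈ 𝒯, cyl n s ∩ A) (fun ω hω => ?_)
    ((measure_biUnion_null_iff h𝒯).2 fun s _ => h s)
  obtain ⟨s, hs, hωs⟩ := hcov ω
  exact mem_biUnion hs ⟨hωs, hω⟩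

end PathSpace

section Paths

variable {S : Type} [MeasurableSpace S] (X : MarkovChain S)

/-- There is a path of length `n` from `i` to `j` with positive transition probabilities. -/
def Reach (n : ℕ) (i j : S) : Prop :=
  ∃ s : ℕ → S, s 0 = i ∧ s n = j ∧ ∀ k < n, 0 < X.P (s k) (s (k + 1))

variable {X}

lemma Reach.trans {n m : ℕ} {i j l : S} (h : X.Reach n i j) (h' : X.Reach m j l) :
    X.Reach (m + n) i l := by
  obtain ⟨s, hs0, hsn, hs⟩ := h
  obtain ⟨t, ht0, htm, ht⟩ := h'
  have e : t 0 = s n := ht0.trans hsn.symm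
  refine ⟨concat n s t, by rw [concat_of_le s t (Nat.zero_le _), hs0], by rw [concat_add e, htm],
    fun k hk => ?_⟩
  by_cases hkn : k < n
  · rw [concat_of_le s t hkn.le, concat_of_le s t hkn]
    exact hs k hkn
  · obtain ⟨c, rfl⟩ := Nat.exists_eq_add_of_le' (not_lt.1 hkn)
    rw [concat_add e, show c + n + 1 = (c + 1) + n by omega, concat_add e]
    exact ht c (by omega)

lemma reach_of_Pn_pos {n : ℕ} {i j : S} (h : 0 < X.Pn n i j) : X.Reach n i j := by
  induction n generalizing j with
  | zero =>
    have : i = j := by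
      by_contra hij
      simp [Pn, hij] at h
    exact ⟨fun _ => i, rfl, this, by simp⟩
  | succ n ih =>
    have : ∃ k, 0 < X.Pn n i k * X.P k j := by
      by_contra! hcon
      exact absurd h (not_lt.2 (tsum_nonpos hcon))
    obtain ⟨k, hk⟩ := this
    have hP : 0 < X.P k j :=
      (X.P_nonneg k j).lt_of_ne fun h0 => by simp [← h0] at hk
    have h1 := ih (pos_of_mul_pos_left hk hP.le)
    rw [add_comm]
    refine h1.trans ⟨fun m => if m = 0 then k else j, by simp, by simp, fun m hm => ?_⟩
    obtain rfl : m = 0 := by omega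
    simpa using hP

lemma exists_init_pos (X : MarkovChain S) : ∃ i, 0 < X.init i := by
  by_contra! hcon
  exact absurd (hasSum_le hcon X.init_hasSum hasSum_zero) (by norm_num)

lemma measure_cyl_ne_zero {n : ℕ} {s : ℕ → S} (h0 : 0 < X.init (s 0))
    (h : ∀ k < n, 0 < X.P (s k) (s (k + 1))) : X.μ (cyl n s) ≠ 0 := by
  rw [cyl, X.μ_cylinder, Ne, ENNReal.ofReal_eq_zero, not_le]
  exact mul_pos h0 (Finset.prod_pos fun k hk => h k (Finset.mem_range.1 hk))

/-- In an irreducible aperiodic chain every state is reached with positive probability at some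
multiple of `m`. -/
lemma exists_measure_cyl_ne_zero (hirr : X.Irreducible) (hap : X.Aperiodic) {m : ℕ} (hm : 0 < m)
    (i : S) : ∃ n s, m ∣ n ∧ s n = i ∧ X.μ (cyl n s) ≠ 0 := by
  obtain ⟨i₀, hi₀⟩ := exists_init_pos X
  obtain ⟨n₀, hn₀⟩ := hirr i₀ i
  have hT : ∀ n ∈ AddSubmonoid.closure {n | X.Reach n i i}, X.Reach n i i := by
    intro n hn
    induction hn using AddSubmonoid.closure_induction with
    | mem n hn => exact hn
    | zero => exact ⟨fun _ => i, rfl, rfl, by simp⟩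
    | add a b _ _ ha hb => exact hb.trans ha
  have hgcd : Nat.setGcd {n | X.Reach n i i} = 1 :=
    hap i _ fun n _ hn => Nat.setGcd_dvd_of_mem (reach_of_Pn_pos hn)
  obtain ⟨N, hN⟩ := Nat.exists_mem_closure_of_ge {n | X.Reach n i i}
  have hr : X.Reach (m * (n₀ + N) - n₀) i i := by
    refine hT _ (hN _ ?_ (by rw [hgcd]; exact one_dvd _))
    have := Nat.le_mul_of_pos_left (n₀ + N) hm
    omega
  have hr' := (reach_of_Pn_pos hn₀).trans hr
  rw [Nat.sub_add_cancel ((Nat.le_add_right n₀ N).trans (Nat.le_mul_of_pos_left _ hm))] at hr'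
  obtain ⟨s, hs0, hsn, hs⟩ := hr'
  exact ⟨_, s, dvd_mul_right m _, hsn, measure_cyl_ne_zero (by rwa [hs0]) hs⟩

end Paths

section MarkovFamily

variable {S : Type} [MeasurableSpace S] [MeasurableSingletonClass S] [Countable S]

/-- `ρ i` is the law of the chain started from `i`, characterised by the Markov property, and every
state is reached with positive probability at some multiple of each `m ≥ 1`. -/
structure IsMarkovFamily (X : MarkovChain S) (ρ : S → Measure (ℕ → S)) : Prop where
  prob : ∀ i, IsProbabilityMeasure (ρ i)
  markov : ∀ n s E, MeasurableSet E →
    X.μ (cyl n s ∩ pathShift^[n] ⁻¹' E) = X.μ (cyl n s) * ρ (s n) E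
  reach : ∀ m, 0 < m → ∀ i, ∃ n s, m ∣ n ∧ s n = i ∧ X.μ (cyl n s) ≠ 0

variable {X : MarkovChain S} {ρ : S → Measure (ℕ → S)}

omit [MeasurableSingletonClass S] [Countable S] in
lemma measure_cyl_inter_preimage_cyl {n k : ℕ} {s t : ℕ → S} (h : t 0 = s n) :
    X.μ (cyl n s ∩ pathShift^[n] ⁻¹' cyl k t) =
      X.μ (cyl n s) * ENNReal.ofReal (∏ j ∈ Finset.range k, X.P (t j) (t (j + 1))) := by
  rw [cyl_inter_preimage_cyl h, cyl, cyl, X.μ_cylinder, X.μ_cylinder,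
    ← ENNReal.ofReal_mul (mul_nonneg (X.init_nonneg _)
      (Finset.prod_nonneg fun _ _ => X.P_nonneg _ _)), mul_assoc, add_comm k n,
    Finset.prod_range_add, concat_of_le s t (Nat.zero_le n)]
  congr 3
  · refine Finset.prod_congr rfl fun j hj => ?_
    have hj := Finset.mem_range.1 hj
    rw [concat_of_le s t hj.le, concat_of_le s t hj]
  · refine Finset.prod_congr rfl fun j _ => ?_
    rw [add_comm n j, concat_add h, show j + n + 1 = (j + 1) + n by omega, concat_add h]

lemma measure_cyl_inter_mul_comm {n m : ℕ} {s t : ℕ → S} (h : s n = t m)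
    {E : Set (ℕ → S)} (hE : MeasurableSet E) :
    X.μ (cyl n s ∩ pathShift^[n] ⁻¹' E) * X.μ (cyl m t) =
      X.μ (cyl m t ∩ pathShift^[m] ⁻¹' E) * X.μ (cyl n s) := by
  have := X.μ_prob
  have hfin : ∀ (n : ℕ) (s : ℕ → S) (c : ENNReal), c ≠ ⊤ →
      IsFiniteMeasure (c • (X.μ.restrict (cyl n s)).map pathShift^[n]) := fun n s c hc =>
    Measure.smul_finite _ hc
  have hap : ∀ (n : ℕ) (s : ℕ → S) (c : ENNReal) (A : Set (ℕ → S)), MeasurableSet A →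
      (c • (X.μ.restrict (cyl n s)).map pathShift^[n]) A =
        X.μ (cyl n s ∩ pathShift^[n] ⁻¹' A) * c := by
    intro n s c A hA
    rw [Measure.smul_apply, Measure.map_apply (measurable_pathShift.iterate n) hA,
      Measure.restrict_apply (measurable_pathShift.iterate n hA), smul_eq_mul, mul_comm,
      inter_comm]
  have key : X.μ (cyl m t) • (X.μ.restrict (cyl n s)).map pathShift^[n] =
      X.μ (cyl n s) • (X.μ.restrict (cyl m t)).map pathShift^[m] := by
    have := hfin n s _ (measure_ne_top X.μ (cyl m t))
    have := hfin m t _ (measure_ne_top X.μ (cyl n s))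
    refine ext_of_generate_finite _ generateFrom_cyl isPiSystem_cyl ?_ ?_
    · rintro _ ⟨k, u, rfl⟩
      rw [hap _ _ _ _ (measurableSet_cyl k u), hap _ _ _ _ (measurableSet_cyl k u)]
      by_cases hu : u 0 = s n
      · rw [measure_cyl_inter_preimage_cyl hu, measure_cyl_inter_preimage_cyl (hu.trans h)]
        ring
      · rw [cyl_inter_preimage_cyl_of_ne hu, cyl_inter_preimage_cyl_of_ne (h ▸ hu)]
        simp
    · rw [hap _ _ _ _ .univ, hap _ _ _ _ .univ]
      simp [mul_comm]
  have := congrArg (fun κ : Measure (ℕ → S) => κ E) key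
  rwa [hap _ _ _ _ hE, hap _ _ _ _ hE] at this

lemma exists_isMarkovFamily (hirr : X.Irreducible) (hap : X.Aperiodic) :
    ∃ ρ, X.IsMarkovFamily ρ := by
  have := X.μ_prob
  choose n s _ hsn hpos using fun i => exists_measure_cyl_ne_zero hirr hap Nat.one_pos i
  have happ : ∀ i A, MeasurableSet A →
      ((X.μ (cyl (n i) (s i)))⁻¹ • (X.μ.restrict (cyl (n i) (s i))).map pathShift^[n i]) A =
        (X.μ (cyl (n i) (s i)))⁻¹ * X.μ (cyl (n i) (s i) ∩ pathShift^[n i] ⁻¹' A) := by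
    intro i A hA
    rw [Measure.smul_apply, Measure.map_apply (measurable_pathShift.iterate _) hA,
      Measure.restrict_apply (measurable_pathShift.iterate _ hA), smul_eq_mul, inter_comm]
  refine ⟨fun i => (X.μ (cyl (n i) (s i)))⁻¹ •
    (X.μ.restrict (cyl (n i) (s i))).map pathShift^[n i], fun i => ⟨?_⟩, fun m t E hE => ?_,
    fun m hm i => exists_measure_cyl_ne_zero hirr hap hm i⟩
  · rw [happ i _ .univ, preimage_univ, inter_univ,
      ENNReal.inv_mul_cancel (hpos i) (measure_ne_top _ _)]
  · rw [happ _ _ hE, mul_left_comm, mul_comm (_⁻¹), ← div_eq_mul_inv,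
      ENNReal.eq_div_iff (hpos _) (measure_ne_top _ _), mul_comm,
      ← measure_cyl_inter_mul_comm (hsn (t m)) hE, mul_comm]

end MarkovFamily

section Levy

variable {S : Type} [MeasurableSpace S] [Countable S]
  {X : MarkovChain S} {ρ : S → Measure (ℕ → S)}

lemma IsMarkovFamily.measure_preimage_eq_zero (hρ : X.IsMarkovFamily ρ) {F : Set (ℕ → S)}
    (hF : MeasurableSet F) (h0 : Measure.sum ρ F = 0) (n : ℕ) :
    X.μ (pathShift^[n] ⁻¹' F) = 0 :=
  measure_eq_zero_of_cyl n fun s => by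
    rw [hρ.markov n s F hF, Measure.sum_apply_eq_zero.1 h0, mul_zero]

lemma IsMarkovFamily.absolutelyContinuous (hρ : X.IsMarkovFamily ρ) : X.μ ≪ Measure.sum ρ :=
  Measure.AbsolutelyContinuous.mk fun _ hF h0 => hρ.measure_preimage_eq_zero hF h0 0

lemma IsMarkovFamily.quasiMeasurePreserving (hρ : X.IsMarkovFamily ρ) :
    Measure.QuasiMeasurePreserving pathShift (Measure.sum ρ) (Measure.sum ρ) := by
  refine ⟨measurable_pathShift, Measure.AbsolutelyContinuous.mk fun F hF h0 => ?_⟩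
  rw [Measure.map_apply measurable_pathShift hF, Measure.sum_apply_eq_zero]
  intro i
  obtain ⟨n, s, -, rfl, hpos⟩ := hρ.reach 1 one_pos i
  have h1 := hρ.markov n s _ (measurable_pathShift hF)
  have h2 : X.μ (cyl n s ∩ pathShift^[n] ⁻¹' (pathShift ⁻¹' F)) = 0 :=
    measure_mono_null inter_subset_right (by
      simpa [← preimage_comp, ← Function.iterate_succ'] using
        hρ.measure_preimage_eq_zero hF h0 (n + 1))
  rw [h2] at h1
  exact (mul_eq_zero.1 h1.symm).resolve_left hpos

lemma IsMarkovFamily.sum_eq_zero (hρ : X.IsMarkovFamily ρ) {m : ℕ} (hm : 0 < m)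
    {F : Set (ℕ → S)} (hF : MeasurableSet F) (hFi : pathShift^[m] ⁻¹' F = F) (h0 : X.μ F = 0) :
    Measure.sum ρ F = 0 := by
  rw [Measure.sum_apply_eq_zero]
  intro i
  obtain ⟨n, s, hmn, rfl, hpos⟩ := hρ.reach m hm i
  have h1 := hρ.markov n s F hF
  rw [iterate_preimage_eq_of_dvd hFi hmn, measure_mono_null inter_subset_right h0] at h1
  exact (mul_eq_zero.1 h1.symm).resolve_left hpos

lemma IsMarkovFamily.ae_le_sum (hρ : X.IsMarkovFamily ρ) {m : ℕ} (hm : 0 < m)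
    {E F : Set (ℕ → S)} (hE : MeasurableSet E) (hEi : pathShift^[m] ⁻¹' E = E)
    (hF : MeasurableSet F) (hFi : pathShift^[m] ⁻¹' F = F) (h : E ≤ᵐ[X.μ] F) :
    E ≤ᵐ[Measure.sum ρ] F := by
  rw [ae_le_set] at h ⊢
  exact hρ.sum_eq_zero hm (hE.diff hF) (by rw [preimage_sdiff, hEi, hFi]) h

lemma IsMarkovFamily.ae_eq_sum (hρ : X.IsMarkovFamily ρ) {m : ℕ} (hm : 0 < m)
    {E F : Set (ℕ → S)} (hE : MeasurableSet E) (hEi : pathShift^[m] ⁻¹' E = E)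
    (hF : MeasurableSet F) (hFi : pathShift^[m] ⁻¹' F = F) (h : E =ᵐ[X.μ] F) :
    E =ᵐ[Measure.sum ρ] F :=
  (hρ.ae_le_sum hm hE hEi hF hFi h.le).antisymm (hρ.ae_le_sum hm hF hFi hE hEi h.symm.le)

lemma ae_measure_cyl_ne_zero (μ : Measure (ℕ → S)) : ∀ᵐ ω ∂μ, ∀ n, μ (cyl n ω) ≠ 0 := by
  rw [ae_all_iff]
  intro n
  refine measure_eq_zero_of_cyl n fun s => ?_
  rcases (cyl n s ∩ {ω | μ (cyl n ω) ≠ 0}ᶜ).eq_empty_or_nonempty with h | ⟨ω, hω, h⟩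
  · exact h ▸ measure_empty
  · have h' : μ (cyl n ω) = 0 := not_not.1 h
    rw [cyl_congr hω] at h'
    exact measure_mono_null inter_subset_left h'

omit [Countable S] in
lemma measurableSet_piLE_cyl [MeasurableSingletonClass S] (n : ℕ) (ω : ℕ → S) :
    MeasurableSet[Filtration.piLE (X := fun _ : ℕ => S) n] (cyl n ω) := by
  refine ⟨{Preorder.restrictLe n ω}, measurableSet_singleton _, ?_⟩
  ext x
  simp [cyl, funext_iff, Preorder.restrictLe]

omit [Countable S] in
lemma eq_of_mem_cyl {n : ℕ} {f : (ℕ → S) → ℝ}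
    (hf : StronglyMeasurable[Filtration.piLE (X := fun _ : ℕ => S) n] f) {ω ω' : ℕ → S}
    (h : ω' ∈ cyl n ω) : f ω' = f ω := by
  refine hf.measurable.factorsThrough ?_
  ext ⟨k, hk⟩
  exact h k hk

omit [Countable S] in
lemma pi_le_iSup_piLE :
    (inferInstance : MeasurableSpace (ℕ → S)) ≤ ⨆ n, Filtration.piLE (X := fun _ : ℕ => S) n := by
  refine iSup_le fun k => le_trans ?_ (le_iSup _ k)
  rintro _ ⟨B, hB, rfl⟩
  exact ⟨(fun x : (i : Iic k) → S => x ⟨k, mem_Iic.2 le_rfl⟩) ⁻¹' B,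
    measurable_pi_apply (⟨k, mem_Iic.2 le_rfl⟩ : Iic k) hB, rfl⟩

/-- Lévy's zero-one law: the probability of an `m`-invariant event, seen from the current state of
the `m`-step chain, converges to the indicator of the event. -/
lemma IsMarkovFamily.ae_tendsto_indicator [MeasurableSingletonClass S]
    (hρ : X.IsMarkovFamily ρ) {m : ℕ}
    {E : Set (ℕ → S)} (hE : MeasurableSet E) (hEi : pathShift^[m] ⁻¹' E = E) (hm : 0 < m) :
    ∀ᵐ ω ∂X.μ, Tendsto (fun k => (ρ (ω (k * m))).real E) atTop
      (nhds (E.indicator (fun _ => (1 : ℝ)) ω)) := by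
  have := X.μ_prob
  have hint : Integrable (E.indicator fun _ => (1 : ℝ)) X.μ := (integrable_const 1).indicator hE
  have hlim := hint.tendsto_ae_condExp (ℱ := Filtration.piLE (X := fun _ : ℕ => S))
    (stronglyMeasurable_const.indicator (pi_le_iSup_piLE _ hE))
  filter_upwards [hlim, ae_measure_cyl_ne_zero X.μ] with ω hω hpos
  have hsub : Tendsto (fun k : ℕ => k * m) atTop atTop :=
    tendsto_id.atTop_mul_const' hm
  refine (hω.comp hsub).congr fun k => ?_
  set n := k * m
  have h1 : ∫ x in cyl n ω, (X.μ[E.indicator fun _ => (1 : ℝ) |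
      Filtration.piLE (X := fun _ : ℕ => S) n]) x ∂X.μ = X.μ.real (cyl n ω ∩ E) := by
    rw [setIntegral_condExp _ hint (measurableSet_piLE_cyl n ω), integral_indicator hE,
      Measure.restrict_restrict hE]
    simp [inter_comm]
  rw [setIntegral_congr_fun (measurableSet_cyl n ω)
    (fun x hx => eq_of_mem_cyl stronglyMeasurable_condExp hx), setIntegral_const] at h1
  have h2 : X.μ.real (cyl n ω ∩ E) = X.μ.real (cyl n ω) * (ρ (ω n)).real E := by
    have := hρ.markov n ω E hE
    rw [iterate_preimage_eq_of_dvd hEi (dvd_mul_left m k)] at this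
    simp only [measureReal_def, this, ENNReal.toReal_mul]
  rw [h2, smul_eq_mul] at h1
  exact mul_left_cancel₀ (ENNReal.toReal_ne_zero.2 ⟨hpos n, measure_ne_top _ _⟩) h1

/-- The states from which the event `E` has probability larger than one half. -/
def likelySet (ρ : S → Measure (ℕ → S)) (E : Set (ℕ → S)) : Set S := {i | 1 / 2 < (ρ i).real E}

lemma IsMarkovFamily.U_L_likelySet_ae_eq [MeasurableSingletonClass S]
    (hρ : X.IsMarkovFamily ρ) {m : ℕ}
    {E : Set (ℕ → S)} (hE : MeasurableSet E) (hEi : pathShift^[m] ⁻¹' E = E) (hm : 0 < m) :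
    X.U m (likelySet ρ E) =ᵐ[X.μ] E ∧ X.L m (likelySet ρ E) =ᵐ[X.μ] E := by
  have key : ∀ᵐ ω ∂X.μ, (ω ∈ E → ∃ n, ∀ k, n ≤ k → ω (k * m) ∈ likelySet ρ E) ∧
      (ω ∉ E → ∃ n, ∀ k, n ≤ k → ω (k * m) ∉ likelySet ρ E) := by
    filter_upwards [hρ.ae_tendsto_indicator hE hEi hm] with ω hω
    refine ⟨fun h => ?_, fun h => ?_⟩
    · rw [indicator_of_mem h] at hω
      exact eventually_atTop.1 (hω.eventually_const_lt (by norm_num : (1 / 2 : ℝ) < 1))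
    · rw [indicator_of_notMem h] at hω
      obtain ⟨n, hn⟩ := eventually_atTop.1
        (hω.eventually_lt_const (by norm_num : (0 : ℝ) < 1 / 2))
      exact ⟨n, fun k hk => not_lt.2 (hn k hk).le⟩
  constructor
  · filter_upwards [key] with ω hω
    refine propext ⟨fun h => ?_, fun h n => ?_⟩
    · by_contra hE'
      obtain ⟨n, hn⟩ := hω.2 hE'
      obtain ⟨k, hk, hk'⟩ := h n
      exact hn k hk hk'
    · obtain ⟨N, hN⟩ := hω.1 h
      exact ⟨max n N, le_max_left _ _, hN _ (le_max_right _ _)⟩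
  · filter_upwards [key] with ω hω
    refine propext ⟨fun h => ?_, fun h => hω.1 h⟩
    by_contra hE'
    obtain ⟨n, hn⟩ := hω.2 hE'
    obtain ⟨N, hN⟩ := h
    exact hn (max n N) (le_max_left _ _) (hN _ (le_max_right _ _))

lemma disjoint_likelySet (hρ : ∀ i, IsProbabilityMeasure (ρ i)) {E F : Set (ℕ → S)}
    (hF : MeasurableSet F) (h : AEDisjoint (Measure.sum ρ) E F) :
    Disjoint (likelySet ρ E) (likelySet ρ F) := by
  rw [disjoint_left]
  intro i (hi : 1 / 2 < (ρ i).real E) (hi' : 1 / 2 < (ρ i).real F)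
  have := hρ i
  have h0 : (ρ i).real (E ∩ F) = 0 := by
    rw [measureReal_def, Measure.sum_apply_eq_zero.1 h i, ENNReal.toReal_zero]
  have h1 := measureReal_union_add_inter (μ := ρ i) (s := E) hF
  have h2 : (ρ i).real (E ∪ F) ≤ 1 := measureReal_le_one
  linarith

end Levy

section BlackwellDecomposition

variable {S : Type} [MeasurableSpace S]

lemma L_preimage (X : MarkovChain S) (m : ℕ) (C : Set S) :
    pathShift^[m] ⁻¹' X.L m C = X.L m C := by
  ext ω
  simp only [L, mem_preimage, mem_ofPred_eq, pathShift_iterate_apply, ← Nat.succ_mul]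
  constructor
  · rintro ⟨n, hn⟩
    refine ⟨n + 1, fun k hk => ?_⟩
    have := hn (k - 1) (by omega)
    rwa [Nat.succ_eq_add_one, Nat.sub_add_cancel (by omega)] at this
  · rintro ⟨n, hn⟩
    exact ⟨n, fun k hk => hn _ (by omega)⟩

lemma L_mono (X : MarkovChain S) (m : ℕ) {C D : Set S} (h : C ⊆ D) : X.L m C ⊆ X.L m D :=
  fun _ ⟨n, hn⟩ => ⟨n, fun k hk => h (hn k hk)⟩

lemma U_mono (X : MarkovChain S) (m : ℕ) {C D : Set S} (h : C ⊆ D) : X.U m C ⊆ X.U m D :=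
  fun _ hω n => (hω n).imp fun _ hk => ⟨hk.1, h hk.2⟩

lemma L_subset_U (X : MarkovChain S) (m : ℕ) (C : Set S) : X.L m C ⊆ X.U m C :=
  fun _ ⟨N, hN⟩ n => ⟨max n N, le_max_left _ _, hN _ (le_max_right _ _)⟩

lemma L_inter (X : MarkovChain S) (m : ℕ) (C D : Set S) :
    X.L m (C ∩ D) = X.L m C ∩ X.L m D :=
  (subset_inter (X.L_mono m inter_subset_left) (X.L_mono m inter_subset_right)).antisymm
    fun _ ⟨⟨n, hn⟩, ⟨n', hn'⟩⟩ => ⟨max n n', fun k hk =>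
      ⟨hn k ((le_max_left _ _).trans hk), hn' k ((le_max_right _ _).trans hk)⟩⟩

lemma disjoint_L (X : MarkovChain S) (m : ℕ) {C D : Set S} (h : Disjoint C D) :
    Disjoint (X.L m C) (X.L m D) := by
  rw [disjoint_iff_inter_eq_empty, ← L_inter, disjoint_iff_inter_eq_empty.1 h,
    eq_empty_iff_forall_notMem]
  exact fun ω ⟨n, hn⟩ => hn n le_rfl

lemma L_one_subset_L (X : MarkovChain S) {m : ℕ} (hm : 0 < m) (C : Set S) :
    X.L 1 C ⊆ X.L m C := fun ω ⟨n, hn⟩ => ⟨n, fun k hk => by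
  simpa using hn (k * m) (hk.trans (Nat.le_mul_of_pos_right k hm))⟩

lemma U_subset_U_one (X : MarkovChain S) {m : ℕ} (hm : 0 < m) (C : Set S) :
    X.U m C ⊆ X.U 1 C := fun ω hω n => by
  obtain ⟨k, hk, hk'⟩ := hω n
  exact ⟨k * m, hk.trans (Nat.le_mul_of_pos_right k hm), by simpa using hk'⟩

variable {X : MarkovChain S} {ρ : S → Measure (ℕ → S)} {m : ℕ} {C D : Set S}
  {E F : Set (ℕ → S)}

lemma regular_iff : X.Regular m C ↔ X.U m C =ᵐ[X.μ] X.L m C := measure_symmDiff_eq_zero_iff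

lemma almostClosed_of_ae_eq (hU : X.U m C =ᵐ[X.μ] E) (hL : X.L m C =ᵐ[X.μ] E) (h : X.μ E ≠ 0) :
    X.AlmostClosed m C :=
  ⟨regular_iff.2 (hU.trans hL.symm), fun h0 => h (by rw [← measure_congr hU]; exact h0)⟩

lemma Simple.exists_isBlackwell_singleton (hX : X.Simple) : ∃ C, X.IsBlackwell 1 {C} := by
  have hne : (Set.encard '' {𝒞 : Set (Set S) | X.IsBlackwell 1 𝒞}).Nonempty := by
    rw [nonempty_iff_ne_empty]
    intro h
    rw [Simple, beta, h, sInf_empty] at hX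
    exact ENat.top_ne_one hX
  obtain ⟨𝒞, h𝒞, h⟩ := csInf_mem hne
  obtain ⟨C, rfl⟩ := encard_eq_one.1 (h.trans hX)
  exact ⟨C, h𝒞⟩

lemma IsBlackwell.measure_L_eq_one (h : X.IsBlackwell m {C}) : X.μ (X.L m C) = 1 := by
  rw [← h.sum_L_eq_one, tsum_singleton C fun D => X.μ (X.L m D)]

variable [MeasurableSingletonClass S] [Countable S]

lemma measurableSet_L (X : MarkovChain S) (m : ℕ) (C : Set S) : MeasurableSet (X.L m C) := by
  have h : X.L m C = ⋃ n : ℕ, ⋂ k : ℕ, ⋂ _ : n ≤ k, (fun ω : ℕ → S => ω (k * m)) ⁻¹' C := by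
    ext ω
    simp [L]
  rw [h]
  exact MeasurableSet.iUnion fun n => MeasurableSet.iInter fun k => MeasurableSet.iInter fun _ =>
    measurable_pi_apply _ C.to_countable.measurableSet

omit [MeasurableSingletonClass S] in
lemma AlmostClosed.sum_L_ne_zero (hρ : X.IsMarkovFamily ρ) (hC : X.AlmostClosed m C) :
    Measure.sum ρ (X.L m C) ≠ 0 := fun h =>
  hC.2 ((measure_congr (regular_iff.1 hC.1)).trans (hρ.absolutelyContinuous h))

lemma IsMarkovFamily.U_L_inter_likelySet_ae_eq (hρ : X.IsMarkovFamily ρ) (hm : 0 < m)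
    (hC : X.Regular m C) (hE : MeasurableSet E) (hEi : pathShift^[m] ⁻¹' E = E) :
    X.U m (C ∩ likelySet ρ E) =ᵐ[X.μ] (X.L m C ∩ E : Set _) ∧
      X.L m (C ∩ likelySet ρ E) =ᵐ[X.μ] (X.L m C ∩ E : Set _) := by
  obtain ⟨hU, hL⟩ := hρ.U_L_likelySet_ae_eq hE hEi hm
  have h1 : X.L m (C ∩ likelySet ρ E) =ᵐ[X.μ] (X.L m C ∩ E : Set _) := by
    rw [L_inter]
    exact (ae_eq_refl _).inter hL
  have h2 : X.U m (C ∩ likelySet ρ E) ≤ᵐ[X.μ] (X.U m C ∩ X.U m (likelySet ρ E) : Set _) :=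
    Eventually.of_forall (subset_inter (X.U_mono m inter_subset_left)
      (X.U_mono m inter_subset_right))
  have h3 : X.L m (C ∩ likelySet ρ E) ≤ᵐ[X.μ] X.U m (C ∩ likelySet ρ E) :=
    Eventually.of_forall (X.L_subset_U m _)
  have h4 : X.U m (C ∩ likelySet ρ E) ≤ᵐ[X.μ] (X.L m C ∩ E : Set _) :=
    EventuallyLE.trans h2 ((regular_iff.1 hC).inter hU).le
  exact ⟨h4.antisymm (EventuallyLE.trans h1.symm.le h3), h1⟩

lemma IsMarkovFamily.almostClosed_inter_likelySet (hρ : X.IsMarkovFamily ρ) (hm : 0 < m)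
    (hC : X.Regular m C) (hE : MeasurableSet E) (hEi : pathShift^[m] ⁻¹' E = E)
    (h : Measure.sum ρ (X.L m C ∩ E) ≠ 0) :
    X.AlmostClosed m (C ∩ likelySet ρ E) ∧
      X.L m (C ∩ likelySet ρ E) =ᵐ[Measure.sum ρ] (X.L m C ∩ E : Set _) := by
  obtain ⟨h1, h2⟩ := hρ.U_L_inter_likelySet_ae_eq hm hC hE hEi
  have hm' := (X.measurableSet_L m C).inter hE
  have hi : pathShift^[m] ⁻¹' (X.L m C ∩ E) = X.L m C ∩ E := by
    rw [preimage_inter, L_preimage, hEi]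
  exact ⟨almostClosed_of_ae_eq h1 h2 fun h0 => h (hρ.sum_eq_zero hm hm' hi h0),
    hρ.ae_eq_sum hm (X.measurableSet_L m _) (X.L_preimage m _) hm' hi h2⟩

lemma IsMarkovFamily.atomic_iff (hρ : X.IsMarkovFamily ρ) (hm : 0 < m)
    (hC : X.AlmostClosed m C) :
    X.Atomic m C ↔ IsInvAtom (Measure.sum ρ) pathShift m (X.L m C) := by
  constructor
  · rintro ⟨-, hat⟩
    refine ⟨X.measurableSet_L m C, X.L_preimage m C, hC.sum_L_ne_zero hρ, fun F hF hFi => ?_⟩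
    by_contra! hcon
    have hFi' : pathShift^[m] ⁻¹' Fᶜ = Fᶜ := by rw [preimage_compl, hFi]
    have h2 := hcon.2
    rw [ae_le_set, sdiff_eq] at h2
    exact hat ⟨_, _, inter_subset_left, inter_subset_left,
      (disjoint_likelySet hρ.prob hF.compl disjoint_compl_right.aedisjoint).mono
        inter_subset_right inter_subset_right,
      (hρ.almostClosed_inter_likelySet hm hC.1 hF hFi hcon.1).1,
      (hρ.almostClosed_inter_likelySet hm hC.1 hF.compl hFi' h2).1⟩
  · refine fun h => ⟨hC, ?_⟩
    rintro ⟨A, B, hA, hB, hAB, hA', hB'⟩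
    rcases h.atom _ (X.measurableSet_L m A) (X.L_preimage m A) with h1 | h1
    · refine hA'.sum_L_ne_zero hρ ?_
      rwa [AEDisjoint, inter_eq_right.2 (X.L_mono m hA)] at h1
    · refine hB'.sum_L_ne_zero hρ ?_
      refine measure_mono_null ?_ (ae_le_set.1 h1)
      exact subset_sdiff.2 ⟨X.L_mono m hB, (X.disjoint_L m hAB).symm⟩

lemma tsum_measure_L {𝒞 : Set (Set S)} (hc : 𝒞.Countable) (hd : 𝒞.PairwiseDisjoint id) :
    ∑' C : 𝒞, X.μ (X.L m (C : Set S)) = X.μ (⋃ C ∈ 𝒞, X.L m C) :=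
  (measure_biUnion hc (fun _ hC _ hD hne => X.disjoint_L m (hd hC hD hne))
    fun C _ => X.measurableSet_L m C).symm

lemma IsBlackwell.exists_not_aedisjoint {𝒞 : Set (Set S)} (h𝒞 : X.IsBlackwell m 𝒞)
    (hρ : X.IsMarkovFamily ρ) (hm : 0 < m) (hF : MeasurableSet F)
    (hFi : pathShift^[m] ⁻¹' F = F) (hF0 : Measure.sum ρ F ≠ 0) :
    ∃ C ∈ 𝒞, ¬ AEDisjoint (Measure.sum ρ) F (X.L m C) := by
  by_contra! hcon
  have := X.μ_prob
  have h1 := h𝒞.sum_L_eq_one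
  rw [tsum_measure_L h𝒞.countable h𝒞.disjoint, ← prob_compl_eq_zero_iff
    (MeasurableSet.biUnion h𝒞.countable fun C _ => X.measurableSet_L m C)] at h1
  have h2 : X.μ (F ∩ ⋃ C ∈ 𝒞, X.L m C) = 0 := by
    rw [inter_iUnion₂, measure_biUnion_null_iff h𝒞.countable]
    exact fun C hC => hρ.absolutelyContinuous (hcon C hC)
  exact hF0 (hρ.sum_eq_zero hm hF hFi (measure_mono_null
    (fun x hx => (em (x ∈ ⋃ C ∈ 𝒞, X.L m C)).imp (fun h => ⟨hx, h⟩) id)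
    (measure_union_null h2 h1)))

/-- If the `m`-invariant events are exhausted by a countable family of atoms, then every Blackwell
decomposition of the `m`-step chain corresponds to this family. -/
lemma IsMarkovFamily.beta_eq_card (hρ : X.IsMarkovFamily ρ) (hm : 0 < m) {ι : Type} [Countable ι]
    {E : ι → Set (ℕ → S)} (hE : ∀ i, IsInvAtom (Measure.sum ρ) pathShift m (E i))
    (hdisj : ∀ i j, i ≠ j → AEDisjoint (Measure.sum ρ) (E i) (E j))
    (hexh : ∀ G, Measure.sum ρ G ≠ 0 → ∃ i, ¬ AEDisjoint (Measure.sum ρ) G (E i)) :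
    X.beta m = ENat.card ι := by
  have hL (i : ι) : X.AlmostClosed m (likelySet ρ (E i)) ∧
      E i =ᵐ[Measure.sum ρ] X.L m (likelySet ρ (E i)) := by
    obtain ⟨h1, h2⟩ := hρ.U_L_likelySet_ae_eq (hE i).meas (hE i).inv hm
    exact ⟨almostClosed_of_ae_eq h1 h2 fun h0 =>
      (hE i).ne_zero (hρ.sum_eq_zero hm (hE i).meas (hE i).inv h0),
      hρ.ae_eq_sum hm (hE i).meas (hE i).inv (X.measurableSet_L m _) (X.L_preimage m _) h2.symm⟩
  have hat (i : ι) : X.Atomic m (likelySet ρ (E i)) :=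
    (hρ.atomic_iff hm (hL i).1).2
      ((hE i).congr_ae (hL i).2 (X.measurableSet_L m _) (X.L_preimage m _))
  have hcard (𝒞 : Set (Set S)) (h𝒞 : X.IsBlackwell m 𝒞) : 𝒞.encard = ENat.card ι := by
    have hatom (C : Set S) (hC : C ∈ 𝒞) :
        IsInvAtom (Measure.sum ρ) pathShift m (X.L m C) := by
      have hC' := h𝒞.almostClosed C hC
      by_contra hna
      obtain ⟨i, hi⟩ := hexh _ (hC'.sum_L_ne_zero hρ)
      obtain ⟨h1, h2⟩ := hρ.almostClosed_inter_likelySet hm hC'.1 (hE i).meas (hE i).inv hi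
      have h3 : E i ≤ᵐ[Measure.sum ρ] X.L m C :=
        ((hE i).atom _ (X.measurableSet_L m C) (X.L_preimage m C)).resolve_left
          fun h => hi h.symm
      have h4 : E i =ᵐ[Measure.sum ρ] X.L m (C ∩ likelySet ρ (E i)) := by
        refine EventuallyEq.trans ?_ h2.symm
        filter_upwards [h3] with ω hω
        exact propext ⟨fun h => ⟨hω h, h⟩, fun h => h.2⟩
      refine h𝒞.nonatomicNoAtomicSubset C hC (fun h => hna ((hρ.atomic_iff hm hC').1 h)) _
        inter_subset_left ((hρ.atomic_iff hm h1).2 ?_)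
      exact (hE i).congr_ae h4 (X.measurableSet_L m _) (X.L_preimage m _)
    have hex (C : 𝒞) : ∃ i, X.L m C =ᵐ[Measure.sum ρ] E i := by
      obtain ⟨i, hi⟩ := hexh _ (hatom C C.2).ne_zero
      exact ⟨i, (hatom C C.2).ae_eq_of_not_aedisjoint (hE i) hi⟩
    choose f hf using hex
    refine ENat.card_congr (Equiv.ofBijective f ⟨fun C D hCD => ?_, fun i => ?_⟩)
    · by_contra hne
      refine (hatom C C.2).not_aedisjoint_of_ae_eq ((hf C).trans ?_)
        (X.disjoint_L m (h𝒞.disjoint C.2 D.2 (Subtype.coe_ne_coe.2 hne))).aedisjoint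
      rw [hCD]
      exact (hf D).symm
    · obtain ⟨C, hC, hCi⟩ := h𝒞.exists_not_aedisjoint hρ hm (hE i).meas (hE i).inv (hE i).ne_zero
      refine ⟨⟨C, hC⟩, ?_⟩
      by_contra hne
      exact hCi ((hdisj _ _ (Ne.symm hne)).congr (ae_eq_refl _) (hf ⟨C, hC⟩))
  have hB : X.IsBlackwell m (range fun i => likelySet ρ (E i)) := by
    have hc : (range fun i => likelySet ρ (E i)).Countable := countable_range _
    have hd : (range fun i => likelySet ρ (E i)).PairwiseDisjoint id := by
      rintro _ ⟨i, rfl⟩ _ ⟨j, rfl⟩ hne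
      exact disjoint_likelySet hρ.prob (hE j).meas (hdisj i j fun h => hne (h ▸ rfl))
    refine ⟨hc, ?_, hd, ?_, ?_, ?_, ?_⟩
    · rintro _ ⟨i, rfl⟩
      exact (hL i).1
    · rintro _ ⟨i, rfl⟩ _ - h
      exact absurd (hat i) h
    · rintro _ ⟨i, rfl⟩ h
      exact absurd (hat i) h
    · rintro _ ⟨i, rfl⟩ h
      exact absurd (hat i) h
    · have := X.μ_prob
      rw [tsum_measure_L hc hd, ← prob_compl_eq_zero_iff
        (MeasurableSet.biUnion hc fun C _ => X.measurableSet_L m C)]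
      refine hρ.absolutelyContinuous ?_
      by_contra h0
      obtain ⟨i, hi⟩ := hexh _ h0
      refine hi (AEDisjoint.congr (Disjoint.aedisjoint ?_) (ae_eq_refl _) (hL i).2)
      exact disjoint_compl_left.mono_right (subset_biUnion_of_mem (mem_range_self i))
  exact le_antisymm (sInf_le ⟨_, hB, hcard _ hB⟩) (le_sInf (by
    rintro _ ⟨𝒞, h𝒞, rfl⟩
    exact (hcard 𝒞 h𝒞).ge))

lemma IsMarkovFamily.beta_eq_of_isCyclicSet (hρ : X.IsMarkovFamily ρ)
    (hT : QuasiErgodic pathShift (Measure.sum ρ)) (hm : 0 < m) {d : ℕ}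
    (hE : IsCyclicSet (Measure.sum ρ) pathShift d E)
    (hE' : IsInvAtom (Measure.sum ρ) pathShift m E) : X.beta m = d := by
  have hqm := hT.toQuasiMeasurePreserving
  have key (i j : Fin d) (hij : i < j) :
      AEDisjoint (Measure.sum ρ) (pathShift^[i] ⁻¹' E) (pathShift^[j] ⁻¹' E) := by
    have hij' : (i : ℕ) < j := hij
    have h := (hE.disj (j - i) (Nat.not_dvd_of_pos_of_lt (by omega) (by omega))).preimage
      (hqm.iterate i)
    rwa [iterate_preimage_preimage, Nat.sub_add_cancel hij'.le] at h
  rw [hρ.beta_eq_card hm (E := fun j : Fin d => pathShift^[j] ⁻¹' E)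
    (fun j => hE'.preimage hqm hm j) (fun i j hij => ?_) (fun G hG => ?_)]
  · simp
  · exact hij.lt_or_gt.elim (key i j) fun h => (key j i h).symm
  · obtain ⟨j, hj⟩ := hT.toPreErgodic.exists_not_aedisjoint hT.measurable hE.pos hE.meas hE.inv
      hE.ne_zero hG
    rw [iterate_preimage_eq_preimage_mod hE.inv] at hj
    exact ⟨⟨j % d, Nat.mod_lt _ hE.pos⟩, hj⟩

/-- A chain whose invariant events form a nonatomic algebra has simple iterates. -/
lemma IsMarkovFamily.beta_eq_one_of_not_atomic (hρ : X.IsMarkovFamily ρ)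
    (hC : X.IsBlackwell 1 {C}) (hna : ¬ X.Atomic 1 C) (hm : 0 < m) : X.beta m = 1 := by
  have := X.μ_prob
  have hC1 := hC.almostClosed C rfl
  have hL1 : X.L 1 C =ᵐ[X.μ] univ :=
    ae_eq_univ.2 ((prob_compl_eq_zero_iff (X.measurableSet_L 1 C)).2 hC.measure_L_eq_one)
  have huniv {G : Set (ℕ → S)} (h : X.L 1 C ⊆ G) : G =ᵐ[X.μ] univ :=
    ae_eq_univ.2 (measure_mono_null (compl_subset_compl.2 h) (ae_eq_univ.1 hL1))
  have hLm := huniv (X.L_one_subset_L hm C)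
  have hCm : X.AlmostClosed m C := almostClosed_of_ae_eq
    (huniv ((X.L_one_subset_L hm C).trans (X.L_subset_U m C))) hLm (by simp)
  have hB : X.IsBlackwell m {C} := by
    refine ⟨countable_singleton C, ?_, pairwiseDisjoint_singleton _ _, ?_, ?_, ?_, ?_⟩
    · rintro _ rfl
      exact hCm
    · rintro _ rfl _ rfl _ _
      rfl
    · rintro D hD - A hA hat
      obtain rfl : C = D := hD.symm
      have hA' := ((hρ.atomic_iff hm hat.1).1 hat).iUnion_preimage hρ.quasiMeasurePreserving hm
      set G := ⋃ i : ℕ, pathShift^[1 * i] ⁻¹' X.L m A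
      have hL1' : X.L 1 C =ᵐ[Measure.sum ρ] univ := hρ.ae_eq_sum one_pos (X.measurableSet_L 1 _)
        (X.L_preimage 1 _) MeasurableSet.univ preimage_univ hL1
      have hG : (X.L 1 C ∩ G : Set _) =ᵐ[Measure.sum ρ] G := by
        simpa using hL1'.inter (ae_eq_refl G)
      obtain ⟨h1, h2⟩ := hρ.almostClosed_inter_likelySet one_pos hC1.1 hA'.meas hA'.inv
        (by rw [measure_congr hG]; exact hA'.ne_zero)
      exact hC.nonatomicNoAtomicSubset _ rfl hna _ inter_subset_left
        ((hρ.atomic_iff one_pos h1).2 (hA'.congr_ae (h2.trans hG).symm (X.measurableSet_L 1 _)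
          (X.L_preimage 1 _)))
    · rintro _ rfl - i hi
      exact measure_mono_null (X.U_subset_U_one hm {i})
        (hC.nonatomicTransientStates _ rfl hna i hi)
    · rw [tsum_singleton C fun D => X.μ (X.L m D), measure_congr hLm, measure_univ]
  refine le_antisymm (sInf_le ⟨_, hB, encard_singleton C⟩) (le_sInf ?_)
  rintro _ ⟨𝒞, h𝒞, rfl⟩
  rw [one_le_encard_iff_nonempty, nonempty_iff_ne_empty]
  rintro rfl
  simpa using h𝒞.sum_L_eq_one

lemma IsMarkovFamily.quasiErgodic (hρ : X.IsMarkovFamily ρ)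
    (hC : X.IsBlackwell 1 {C}) (hat : X.Atomic 1 C) : QuasiErgodic pathShift (Measure.sum ρ) := by
  have := X.μ_prob
  refine ((hρ.atomic_iff one_pos hat.1).1 hat).quasiErgodic hρ.quasiMeasurePreserving
    (hρ.sum_eq_zero one_pos (X.measurableSet_L 1 C).compl ?_ ?_)
  · rw [preimage_compl, L_preimage]
  · exact (prob_compl_eq_zero_iff (X.measurableSet_L 1 C)).2 hC.measure_L_eq_one

end BlackwellDecomposition

end MarkovChain

variable {S : Type} [MeasurableSpace S] [MeasurableSingletonClass S]
  [Countable S] [Infinite S]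

/-- Let `X` be simple and `k, ℓ ≥ 1`. If `β(X^(k))` and `β(X^(ℓ))`
are relatively prime, then `β(X^(kℓ)) = β(X^(k)) · β(X^(ℓ))`. -/
theorem stmt7 (X : MarkovChain S) (hirr : X.Irreducible) (hap : X.Aperiodic)
    (hsimple : X.Simple) (k l : ℕ) (hk : 1 ≤ k) (hl : 1 ≤ l)
    (bk bl : ℕ) (hbk : X.beta k = (bk : ℕ∞)) (hbl : X.beta l = (bl : ℕ∞))
    (hcop : Nat.Coprime bk bl) :
    X.beta (k * l) = ((bk * bl : ℕ) : ℕ∞) := by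
  obtain ⟨ρ, hρ⟩ := X.exists_isMarkovFamily hirr hap
  obtain ⟨C, hC⟩ := hsimple.exists_isBlackwell_singleton
  by_cases hat : X.Atomic 1 C
  · have hT := hρ.quasiErgodic hC hat
    have hν : Measure.sum ρ ≠ 0 := fun h => hat.1.sum_L_ne_zero hρ (by simp [h])
    have hkl := Nat.mul_pos hk hl
    obtain ⟨a, E, ha, hE, hE'⟩ := hT.exists_isCyclicSet_isInvAtom hν hk
    obtain ⟨b, F, hb, hF, hF'⟩ := hT.exists_isCyclicSet_isInvAtom hν hl
    obtain ⟨n, G, hn, hG, hG'⟩ := hT.exists_isCyclicSet_isInvAtom hν hkl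
    rw [hρ.beta_eq_of_isCyclicSet hT hk hE hE', Nat.cast_inj] at hbk
    rw [hρ.beta_eq_of_isCyclicSet hT hl hF hF', Nat.cast_inj] at hbl
    subst hbk hbl
    rw [hρ.beta_eq_of_isCyclicSet hT hkl hG hG',
      hE.eq_mul_of_coprime hT hk hl ha hb hE' hF hF' hn hG hG' hcop]
  · have h1 (m : ℕ) (hm : 0 < m) : X.beta m = 1 := hρ.beta_eq_one_of_not_atomic hC hat hm
    rw [h1 k hk, eq_comm, Nat.cast_eq_one] at hbk
    rw [h1 l hl, eq_comm, Nat.cast_eq_one] at hbl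
    rw [h1 _ (Nat.mul_pos hk hl), hbk, hbl]
    simp
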